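/- Suppose A is Γ-graded D-simple and the index set 𝒥 is infinite. Then W = A[D], where W = [A[D],A[D]]. -/

import Mathlib

/-- A skew-symmetric bicharacter `ε : Γ × Γ → F^×`. -/
def IsBichar {F : Type} [Field F] {Γ : Type} [AddCommGroup Γ] (ε : Γ → Γ → F) : Prop :=
  (∀ lam mu, ε lam mu * ε mu lam = 1) ∧
  (∀ lam mu nu, ε lam (mu + nu) = ε lam mu * ε lam nu)

variable (F : Type) [Field F] (Γ : Type) [AddCommGroup Γ] [DecidableEq Γ]
  (A : Type) [Ring A] [Algebra F A]

/-- left multiplication operators -/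
noncomputable def mulL : A →ₗ[F] Module.End F A := (Algebra.lmul F A).toLinearMap

variable {F Γ A}

/-- `f ∈ End_F(A)` is homogeneous of degree `δ`. -/
def IsHomogMap (𝒜 : Γ → Submodule F A) (δ : Γ) (f : Module.End F A) : Prop :=
  ∀ lam : Γ, ∀ a ∈ 𝒜 lam, f a ∈ 𝒜 (lam + δ)

/-- `f` is a homogeneous color-derivation of degree `δ`. -/
def IsColorDer (𝒜 : Γ → Submodule F A) (ε : Γ → Γ → F) (δ : Γ) (f : Module.End F A) : Prop :=
  IsHomogMap 𝒜 δ f ∧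
  ∀ lam : Γ, ∀ a ∈ 𝒜 lam, ∀ b : A, f (a * b) = f a * b + ε δ lam • (a * f b)

/-- `Der^ε(A)`: the F-span of homogeneous color derivations. -/
def DerE (𝒜 : Γ → Submodule F A) (ε : Γ → Γ → F) : Submodule F (Module.End F A) :=
  Submodule.span F {f | ∃ δ, IsColorDer 𝒜 ε δ f}

/-- `A` is ε-commutative. -/
def IsColorComm (𝒜 : Γ → Submodule F A) (ε : Γ → Γ → F) : Prop :=
  ∀ lam mu : Γ, ∀ a ∈ 𝒜 lam, ∀ b ∈ 𝒜 mu, a * b = ε lam mu • (b * a)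

/-- `D` is color-commutative. -/
def DColorComm (𝒜 : Γ → Submodule F A) (ε : Γ → Γ → F) (D : Submodule F (Module.End F A)) : Prop :=
  ∀ δ δ' f g, f ∈ D → g ∈ D → IsColorDer 𝒜 ε δ f → IsColorDer 𝒜 ε δ' g →
    f * g = ε δ δ' • (g * f)

/-- `D` is a Γ-graded subspace: it is spanned by its homogeneous color-derivations. -/
def DGraded (𝒜 : Γ → Submodule F A) (ε : Γ → Γ → F) (D : Submodule F (Module.End F A)) : Prop :=
  D = Submodule.span F {f | f ∈ D ∧ ∃ δ, IsColorDer 𝒜 ε δ f}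

/-- `A[D]`: the unital subalgebra of `End_F(A)` generated by left multiplications and `D`. -/
noncomputable def AD (D : Submodule F (Module.End F A)) : Subalgebra F (Module.End F A) :=
  Algebra.adjoin F (Set.range (mulL F A) ∪ (D : Set (Module.End F A)))

/-- `A` is Γ-graded `D`-simple. -/
def GradedDSimple (𝒜 : Γ → Submodule F A) [GradedAlgebra 𝒜] (D : Submodule F (Module.End F A)) :
    Prop :=
  ∀ I : Ideal A, Ideal.IsHomogeneous 𝒜 I → (∀ f ∈ D, ∀ x ∈ I, f x ∈ I) → I = ⊥ ∨ I = ⊤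

/-- F₁ = A^D -/
def F1 (D : Submodule F (Module.End F A)) : Submodule F A where
  carrier := {u | ∀ f ∈ D, f u = 0}
  add_mem' := by
    intro a b ha hb f hf
    rw [map_add, ha f hf, hb f hf, add_zero]
  zero_mem' := by intro f hf; exact map_zero f
  smul_mem' := by
    intro c x hx f hf
    rw [map_smul, hx f hf, smul_zero]

/-- the derived space `W = [A[D], A[D]]`. -/
def Wsub (𝒜 : Γ → Submodule F A) (ε : Γ → Γ → F) (D : Submodule F (Module.End F A)) :
    Submodule F (Module.End F A) :=
  Submodule.span F {w | ∃ γ γ' x y, x ∈ AD D ∧ y ∈ AD D ∧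
    IsHomogMap 𝒜 γ x ∧ IsHomogMap 𝒜 γ' y ∧ w = x * y - ε γ γ' • (y * x)}

/-- `F₁[D]`. -/
noncomputable def F1D (D : Submodule F (Module.End F A)) : Subalgebra F (Module.End F A) :=
  Algebra.adjoin F ((mulL F A '' (F1 D : Set A)) ∪ (D : Set (Module.End F A)))

/-- `𝒟 = Der^ε(A) ∩ F₁[D]`. -/
def DScr (𝒜 : Γ → Submodule F A) (ε : Γ → Γ → F) (D : Submodule F (Module.End F A)) :
    Set (Module.End F A) :=
  {f | f ∈ F1D D ∧ f ∈ DerE 𝒜 ε}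

variable {I : Type} [LinearOrder I]

/-- ordered product `d^α`. -/
noncomputable def dpow (d : I → Module.End F A) (α : I →₀ ℕ) : Module.End F A :=
  ((α.support.sort (· ≤ ·)).map fun i => d i ^ α i).prod

/-- membership in the index set 𝒥. -/
def inJ (ε : Γ → Γ → F) (δd : I → Γ) (α : I →₀ ℕ) : Prop :=
  (∀ i, ringChar F ≠ 0 → α i ≤ ringChar F - 1) ∧
  (∀ i, ε (δd i) (δd i) = -1 → α i ≤ 1)

/-- the degree of `d^α`. -/
def degJ (δd : I → Γ) (α : I →₀ ℕ) : Γ := α.sum fun i n => n • δd i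

/-- the subalgebra `S` of `End_F(A)` is Γ-graded simple. -/
def GradedSimpleAlgOn (𝒜 : Γ → Submodule F A) (S : Subalgebra F (Module.End F A)) : Prop :=
  ∀ L : Submodule F (Module.End F A),
    L ≤ Subalgebra.toSubmodule S →
    (∀ x ∈ S, ∀ y ∈ L, x * y ∈ L ∧ y * x ∈ L) →
    L = Submodule.span F {f | f ∈ L ∧ ∃ δ, IsHomogMap 𝒜 δ f} →
    (L = ⊥ ∨ L = Subalgebra.toSubmodule S)

/-- variant of 𝒥 without characteristic restriction -/
def inJ0 (ε : Γ → Γ → F) (δd : I → Γ) (α : I →₀ ℕ) : Prop :=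
  ∀ i, ε (δd i) (δd i) = -1 → α i ≤ 1

/-- the sum `Σ_{α ∈ J0} B d^α` is direct -/
def DirectOn (d : I → Module.End F A) (J0 : Set (I →₀ ℕ)) (Bs : Set A) : Prop :=
  ∀ (s : Finset (I →₀ ℕ)) (c : (I →₀ ℕ) → A), ↑s ⊆ J0 → (∀ α ∈ s, c α ∈ Bs) →
    (∑ α ∈ s, mulL F A (c α) * dpow d α) = 0 → ∀ α ∈ s, mulL F A (c α) * dpow d α = 0

/-- span of color brackets of homogeneous elements of `M` and `N` -/
def brkE (𝒜 : Γ → Submodule F A) (ε : Γ → Γ → F) (M N : Submodule F (Module.End F A)) :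
    Submodule F (Module.End F A) :=
  Submodule.span F {w | ∃ γ γ' x y, x ∈ M ∧ y ∈ N ∧
    IsHomogMap 𝒜 γ x ∧ IsHomogMap 𝒜 γ' y ∧ w = x * y - ε γ γ' • (y * x)}

set_option linter.unusedSectionVars false

theorem IsBichar.ne_zero {ε : Γ → Γ → F} (hε : IsBichar ε) (x y : Γ) : ε x y ≠ 0 :=
  left_ne_zero_of_mul_eq_one (hε.1 x y)

theorem IsBichar.add_left {ε : Γ → Γ → F} (hε : IsBichar ε) (x y z : Γ) :
    ε (x + y) z = ε x z * ε y z := by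
  have h := hε.1 (x + y) z
  rw [hε.2] at h
  apply mul_right_cancel₀ (mul_ne_zero (hε.ne_zero z x) (hε.ne_zero z y))
  rw [h]
  linear_combination (-1 : F) * (ε y z * ε z y) * hε.1 x z - hε.1 y z

theorem IsBichar.zero_left {ε : Γ → Γ → F} (hε : IsBichar ε) (z : Γ) : ε 0 z = 1 := by
  have h := hε.add_left 0 0 z
  rw [add_zero] at h
  exact mul_left_cancel₀ (hε.ne_zero 0 z) (by rw [← h, mul_one])

@[simp]
theorem mulL_apply (a b : A) : mulL F A a b = a * b := rfl

theorem mulL_mul (a b : A) : mulL F A (a * b) = mulL F A a * mulL F A b :=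
  map_mul (Algebra.lmul F A) a b

theorem mulL_one : mulL F A (1 : A) = 1 := map_one (Algebra.lmul F A)

theorem linearMap_ext_homogeneous (𝒜 : Γ → Submodule F A) [GradedAlgebra 𝒜]
    {f g : Module.End F A} (h : ∀ lam, ∀ a ∈ 𝒜 lam, f a = g a) : f = g := by
  ext a
  induction a using DirectSum.Decomposition.inductionOn 𝒜 with
  | zero => simp
  | homogeneous a => exact h _ _ a.2
  | add a b ha hb => simp [ha, hb]

theorem isHomogMap_mulL (𝒜 : Γ → Submodule F A) [GradedAlgebra 𝒜] {mu : Γ} {a : A}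
    (ha : a ∈ 𝒜 mu) : IsHomogMap 𝒜 mu (mulL F A a) := by
  intro lam b hb
  rw [add_comm]
  exact SetLike.mul_mem_graded ha hb

theorem IsHomogMap.mul {𝒜 : Γ → Submodule F A} {f g : Module.End F A} {x y : Γ}
    (hf : IsHomogMap 𝒜 x f) (hg : IsHomogMap 𝒜 y g) : IsHomogMap 𝒜 (x + y) (f * g) := by
  intro lam a ha
  have := hf _ _ (hg _ _ ha)
  rwa [add_assoc, add_comm y x] at this

theorem IsColorDer.map_one {𝒜 : Γ → Submodule F A} [GradedAlgebra 𝒜] {ε : Γ → Γ → F}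
    (hε : IsBichar ε) {x : Γ} {f : Module.End F A} (hf : IsColorDer 𝒜 ε x f) : f 1 = 0 := by
  have h := hf.2 0 1 SetLike.GradedOne.one_mem 1
  have h0 : ε x 0 = 1 := by simpa [hε.zero_left] using hε.1 x 0
  simpa [h0] using h

theorem IsColorDer.mul_mulL {𝒜 : Γ → Submodule F A} {ε : Γ → Γ → F}
    {x y : Γ} {f : Module.End F A} (hf : IsColorDer 𝒜 ε x f) {a : A} (ha : a ∈ 𝒜 y) :
    f * mulL F A a = mulL F A (f a) + ε x y • (mulL F A a * f) := by
  ext b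
  simpa using hf.2 y a ha b

/-- The operator scaling the component of degree `lam` by `ε lam mu`. -/
noncomputable def colorTwist (𝒜 : Γ → Submodule F A) [GradedAlgebra 𝒜] (ε : Γ → Γ → F) (mu : Γ) :
    Module.End F A :=
  (DirectSum.toModule F Γ A fun lam => ε lam mu • (𝒜 lam).subtype) ∘ₗ
    (DirectSum.decomposeLinearEquiv 𝒜).toLinearMap

theorem colorTwist_apply (𝒜 : Γ → Submodule F A) [GradedAlgebra 𝒜] (ε : Γ → Γ → F) (mu : Γ)
    {lam : Γ} {a : A} (ha : a ∈ 𝒜 lam) : colorTwist 𝒜 ε mu a = ε lam mu • a := by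
  simp only [colorTwist, LinearMap.comp_apply, LinearEquiv.coe_coe,
    DirectSum.decomposeLinearEquiv_apply, DirectSum.decompose_of_mem 𝒜 ha]
  exact DirectSum.toModule_lof F lam _

theorem commute_colorTwist_iff (𝒜 : Γ → Submodule F A) [GradedAlgebra 𝒜] {ε : Γ → Γ → F}
    (hε : IsBichar ε) {x mu : Γ} {f : Module.End F A} (hf : IsHomogMap 𝒜 x f)
    (g : Module.End F A) :
    g * colorTwist 𝒜 ε mu * f = f * (g * colorTwist 𝒜 ε mu) ↔ f * g = ε x mu • (g * f) := by
  constructor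
  · intro h
    apply linearMap_ext_homogeneous 𝒜
    intro lam a ha
    have h2 := LinearMap.congr_fun h a
    simp only [Module.End.mul_apply, colorTwist_apply 𝒜 ε mu ha,
      colorTwist_apply 𝒜 ε mu (hf _ _ ha), hε.add_left, map_smul, mul_smul] at h2
    exact (smul_right_injective A (hε.ne_zero lam mu) h2).symm
  · intro h
    apply linearMap_ext_homogeneous 𝒜
    intro lam a ha
    have h2 := LinearMap.congr_fun h a
    simp only [Module.End.mul_apply, LinearMap.smul_apply] at h2
    simp only [Module.End.mul_apply, colorTwist_apply 𝒜 ε mu ha,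
      colorTwist_apply 𝒜 ε mu (hf _ _ ha), hε.add_left, map_smul, mul_smul, h2]

theorem DGraded.induction {𝒜 : Γ → Submodule F A} {ε : Γ → Γ → F}
    {D : Submodule F (Module.End F A)} (hD : DGraded 𝒜 ε D) (S : Submodule F (Module.End F A))
    (h : ∀ δ, ∀ f ∈ D, IsColorDer 𝒜 ε δ f → f ∈ S) : D ≤ S := by
  rw [hD, Submodule.span_le]
  rintro f ⟨hf, δ, hδ⟩
  exact h δ f hf hδ

theorem mem_F1_of_homogeneous {𝒜 : Γ → Submodule F A} {ε : Γ → Γ → F}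
    {D : Submodule F (Module.End F A)} (hD : DGraded 𝒜 ε D) {u : A}
    (h : ∀ δ, ∀ f ∈ D, IsColorDer 𝒜 ε δ f → f u = 0) : u ∈ F1 D := by
  intro f hf
  exact hD.induction (LinearMap.ker (LinearMap.applyₗ u : Module.End F A →ₗ[F] A)) h hf

theorem IsHomogMap.decompose_apply {𝒜 : Γ → Submodule F A} [GradedAlgebra 𝒜] {δ : Γ}
    {f : Module.End F A} (hf : IsHomogMap 𝒜 δ f) (u : A) (lam : Γ) :
    (DirectSum.decompose 𝒜 (f u) (lam + δ) : A) = f (DirectSum.decompose 𝒜 u lam) := by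
  induction u using DirectSum.Decomposition.inductionOn 𝒜 with
  | zero => simp
  | add a b ha hb => simp [DirectSum.decompose_add, ha, hb]
  | @homogeneous mu a =>
    by_cases h : mu = lam
    · subst h
      rw [DirectSum.decompose_of_mem_same 𝒜 (hf _ _ a.2), DirectSum.decompose_of_mem_same 𝒜 a.2]
    · rw [DirectSum.decompose_of_mem_ne 𝒜 (hf _ _ a.2) (by simpa using h),
        DirectSum.decompose_of_mem_ne 𝒜 a.2 h, map_zero]

theorem decompose_mem_F1 {𝒜 : Γ → Submodule F A} [GradedAlgebra 𝒜] {ε : Γ → Γ → F}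
    {D : Submodule F (Module.End F A)} (hD : DGraded 𝒜 ε D) {u : A} (hu : u ∈ F1 D) (lam : Γ) :
    (DirectSum.decompose 𝒜 u lam : A) ∈ F1 D := by
  refine mem_F1_of_homogeneous hD fun δ f hf hδ => ?_
  rw [← hδ.1.decompose_apply, hu f hf]
  simp

/-- An operator color-commuting with the generators of `F₁[D]` color-commutes with every
homogeneous element of `F₁[D]`. -/
theorem color_commute_of_mem_F1D {𝒜 : Γ → Submodule F A} [GradedAlgebra 𝒜] {ε : Γ → Γ → F}
    (hε : IsBichar ε) {D : Submodule F (Module.End F A)} (hD : DGraded 𝒜 ε D)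
    {g : Module.End F A} {mu : Γ}
    (hgu : ∀ lam, ∀ u ∈ F1 D, u ∈ 𝒜 lam → mulL F A u * g = ε lam mu • (g * mulL F A u))
    (hgD : ∀ δ, ∀ f ∈ D, IsColorDer 𝒜 ε δ f → f * g = ε δ mu • (g * f))
    {x : Γ} {f : Module.End F A} (hf : f ∈ F1D D) (hx : IsHomogMap 𝒜 x f) :
    f * g = ε x mu • (g * f) := by
  rw [← commute_colorTwist_iff 𝒜 hε hx]
  suffices h : F1D D ≤ Subalgebra.centralizer F {g * colorTwist 𝒜 ε mu} by
    exact (Subalgebra.mem_centralizer_iff F).1 (h hf) _ rfl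
  refine Algebra.adjoin_le ?_
  rintro y (⟨u, hu, rfl⟩ | hy)
  · change mulL F A u ∈ Subalgebra.centralizer F _
    classical
    rw [← DirectSum.sum_support_decompose 𝒜 u, map_sum]
    refine sum_mem fun lam _ => ?_
    rw [Subalgebra.mem_centralizer_iff]
    rintro _ rfl
    rw [commute_colorTwist_iff 𝒜 hε (isHomogMap_mulL 𝒜 (SetLike.coe_mem _))]
    exact hgu _ _ (decompose_mem_F1 hD hu lam) (SetLike.coe_mem _)
  · refine hD.induction (Subalgebra.toSubmodule (Subalgebra.centralizer F _)) ?_ hy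
    intro δ f hf hδ
    rw [Subalgebra.mem_toSubmodule, Subalgebra.mem_centralizer_iff]
    rintro _ rfl
    rw [commute_colorTwist_iff 𝒜 hε hδ.1]
    exact hgD δ f hf hδ

theorem IsColorComm.mulL_comm {𝒜 : Γ → Submodule F A} {ε : Γ → Γ → F} (hcomm : IsColorComm 𝒜 ε)
    {lam mu : Γ} {a b : A} (ha : a ∈ 𝒜 lam) (hb : b ∈ 𝒜 mu) :
    mulL F A a * mulL F A b = ε lam mu • (mulL F A b * mulL F A a) := by
  rw [← mulL_mul, ← mulL_mul, hcomm lam mu a ha b hb, map_smul]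

theorem color_commute_symm {ε : Γ → Γ → F} (hε : IsBichar ε) {x y : Γ} {f g : Module.End F A}
    (h : f * g = ε x y • (g * f)) : g * f = ε y x • (f * g) := by
  rw [h, smul_smul, hε.1, one_smul]

/-- Derivations in `D` color-commute with left multiplications by elements of `F₁`. -/
theorem mulL_F1_comm {𝒜 : Γ → Submodule F A} {ε : Γ → Γ → F} (hε : IsBichar ε)
    {D : Submodule F (Module.End F A)} {δ lam : Γ} {f : Module.End F A} {u : A} (hf : f ∈ D)
    (hδ : IsColorDer 𝒜 ε δ f) (hu : u ∈ F1 D) (hlam : u ∈ 𝒜 lam) :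
    mulL F A u * f = ε lam δ • (f * mulL F A u) := by
  apply color_commute_symm hε
  rw [hδ.mul_mulL hlam, hu f hf, map_zero, zero_add]

theorem F1D_comm_D {𝒜 : Γ → Submodule F A} [GradedAlgebra 𝒜] {ε : Γ → Γ → F}
    (hε : IsBichar ε) {D : Submodule F (Module.End F A)} (hD : DGraded 𝒜 ε D)
    (hDcc : DColorComm 𝒜 ε D) {x δ : Γ} {f g : Module.End F A} (hf : f ∈ F1D D)
    (hx : IsHomogMap 𝒜 x f) (hg : g ∈ D) (hδ : IsColorDer 𝒜 ε δ g) :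
    f * g = ε x δ • (g * f) :=
  color_commute_of_mem_F1D hε hD (fun _ _ hu hlam => mulL_F1_comm hε hg hδ hu hlam)
    (fun _ _ hf₂ hδ₂ => hDcc _ _ _ _ hf₂ hg hδ₂ hδ) hf hx

/-- `F₁[D]` is color-commutative. -/
theorem F1D_comm {𝒜 : Γ → Submodule F A} [GradedAlgebra 𝒜] {ε : Γ → Γ → F}
    (hε : IsBichar ε) (hcomm : IsColorComm 𝒜 ε) {D : Submodule F (Module.End F A)}
    (hD : DGraded 𝒜 ε D)
    (hDcc : DColorComm 𝒜 ε D) {x y : Γ} {f g : Module.End F A} (hf : f ∈ F1D D)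
    (hx : IsHomogMap 𝒜 x f) (hg : g ∈ F1D D) (hy : IsHomogMap 𝒜 y g) :
    f * g = ε x y • (g * f) := by
  refine color_commute_of_mem_F1D hε hD (fun lam u hu hlam => ?_) (fun δ f₂ hf₂ hδ₂ => ?_) hf hx
  · refine color_commute_symm hε (color_commute_of_mem_F1D hε hD ?_ ?_ hg hy)
    · exact fun mu w _ hmu => hcomm.mulL_comm hmu hlam
    · exact fun δ f₂ hf₂ hδ₂ => color_commute_symm hε (mulL_F1_comm hε hf₂ hδ₂ hu hlam)
  · exact color_commute_symm hε (F1D_comm_D hε hD hDcc hg hy hf₂ hδ₂)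

/-- The span of the families `i ↦ ε(b, d_i) c d_i(b)`, for homogeneous `b` and `c`. -/
def derSpan (𝒜 : Γ → Submodule F A) (ε : Γ → Γ → F) (d : I → Module.End F A) (δd : I → Γ) :
    Submodule F (I → A) :=
  Submodule.span F {v | ∃ γ β, ∃ c ∈ 𝒜 γ, ∃ b ∈ 𝒜 β, v = fun i => ε β (δd i) • (c * d i b)}

section derSpan

variable {𝒜 : Γ → Submodule F A} [GradedAlgebra 𝒜] {ε : Γ → Γ → F}
  {d : I → Module.End F A} {δd : I → Γ}

theorem smul_mem_derSpan (a : A) {v : I → A} (hv : v ∈ derSpan 𝒜 ε d δd) :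
    (fun i => a * v i) ∈ derSpan 𝒜 ε d δd := by
  induction hv using Submodule.span_induction with
  | zero =>
    convert (derSpan 𝒜 ε d δd).zero_mem using 1
    ext i
    simp
  | add v w _ _ hv hw =>
    convert add_mem hv hw using 1
    ext i
    simp [mul_add]
  | smul r v _ hv =>
    convert Submodule.smul_mem _ r hv using 1
    ext i
    simp
  | mem v hv =>
    obtain ⟨γ, β, c, hc, b, hb, rfl⟩ := hv
    induction a using DirectSum.Decomposition.inductionOn 𝒜 with
    | zero =>
      convert (derSpan 𝒜 ε d δd).zero_mem using 1
      ext i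
      simp
    | add a a₂ h h₂ =>
      convert add_mem h h₂ using 1
      ext i
      simp [add_mul]
    | @homogeneous mu a =>
      refine Submodule.subset_span ⟨mu + γ, β, a * c, SetLike.mul_mem_graded a.2 hc, b, hb, ?_⟩
      ext i
      simp [mul_assoc]

theorem map_mem_derSpan (hε : IsBichar ε) {δ : Γ} {f : Module.End F A}
    (hf : IsColorDer 𝒜 ε δ f) (hdf : ∀ i, d i * f = ε (δd i) δ • (f * d i))
    {v : I → A} (hv : v ∈ derSpan 𝒜 ε d δd) :
    (fun i => f (v i)) ∈ derSpan 𝒜 ε d δd := by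
  induction hv using Submodule.span_induction with
  | zero =>
    convert (derSpan 𝒜 ε d δd).zero_mem using 1
    ext i
    simp
  | add v w _ _ hv hw =>
    convert add_mem hv hw using 1
    ext i
    simp
  | smul r v _ hv =>
    convert Submodule.smul_mem _ r hv using 1
    ext i
    simp
  | mem v hv =>
    obtain ⟨γ, β, c, hc, b, hb, rfl⟩ := hv
    have h1 : (fun i => ε β (δd i) • (f c * d i b)) ∈ derSpan 𝒜 ε d δd :=
      Submodule.subset_span ⟨_, β, f c, hf.1 _ _ hc, b, hb, rfl⟩
    have h2 : (fun i => ε (β + δ) (δd i) • (c * d i (f b))) ∈ derSpan 𝒜 ε d δd :=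
      Submodule.subset_span ⟨_, _, c, hc, f b, hf.1 _ _ hb, rfl⟩
    convert add_mem h1 (Submodule.smul_mem _ (ε δ γ) h2) using 1
    ext i
    have h3 : d i (f b) = ε (δd i) δ • f (d i b) := LinearMap.congr_fun (hdf i) b
    simp only [map_smul, hf.2 γ c hc, Pi.add_apply, Pi.smul_apply, h3, mul_smul_comm, smul_add,
      smul_smul, hε.add_left]
    congr 2
    linear_combination (-(ε β (δd i) * ε δ γ)) * hε.1 δ (δd i)

theorem decompose_mem_derSpan (hd : ∀ i, IsHomogMap 𝒜 (δd i) (d i)) (tau : Γ)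
    {v : I → A} (hv : v ∈ derSpan 𝒜 ε d δd) :
    (fun i => (DirectSum.decompose 𝒜 (v i) (tau + δd i) : A)) ∈ derSpan 𝒜 ε d δd := by
  induction hv using Submodule.span_induction with
  | zero =>
    convert (derSpan 𝒜 ε d δd).zero_mem using 1
    ext i
    simp
  | add v w _ _ hv hw =>
    convert add_mem hv hw using 1
    ext i
    simp [DirectSum.decompose_add]
  | smul r v _ hv =>
    convert Submodule.smul_mem _ r hv using 1
    ext i
    simp [DirectSum.decompose_smul, DirectSum.smul_apply]
  | mem v hv =>
    obtain ⟨γ, β, c, hc, b, hb, rfl⟩ := hv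
    have hm : ∀ i, ε β (δd i) • (c * d i b) ∈ 𝒜 (γ + β + δd i) := fun i => by
      rw [add_assoc]
      exact Submodule.smul_mem _ _ (SetLike.mul_mem_graded hc (hd i _ _ hb))
    by_cases h : γ + β = tau
    · subst h
      simp only [DirectSum.decompose_of_mem_same 𝒜 (hm _)]
      exact Submodule.subset_span ⟨γ, β, c, hc, b, hb, rfl⟩
    · have h0 : ∀ i, (DirectSum.decompose 𝒜 (ε β (δd i) • (c * d i b)) (tau + δd i) : A) = 0 :=
        fun i => DirectSum.decompose_of_mem_ne 𝒜 (hm i) (by simpa using h)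
      simp only [h0]
      exact (derSpan 𝒜 ε d δd).zero_mem

/-- The ideal of `j`-th coordinates of the elements of `derSpan` vanishing on `S`. -/
def coordIdeal (𝒜 : Γ → Submodule F A) [GradedAlgebra 𝒜] (ε : Γ → Γ → F)
    (d : I → Module.End F A) (δd : I → Γ) (S : Finset I) (j : I) : Ideal A where
  carrier := {a | ∃ v ∈ derSpan 𝒜 ε d δd, (∀ i ∈ S, v i = 0) ∧ v j = a}
  zero_mem' := ⟨0, zero_mem _, by simp, rfl⟩
  add_mem' := by
    rintro _ _ ⟨v, hv, hvS, rfl⟩ ⟨w, hw, hwS, rfl⟩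
    exact ⟨v + w, add_mem hv hw, fun i hi => by simp [hvS i hi, hwS i hi], rfl⟩
  smul_mem' := by
    rintro a _ ⟨v, hv, hvS, rfl⟩
    exact ⟨_, smul_mem_derSpan a hv, fun i hi => by simp [hvS i hi], rfl⟩

theorem coordIdeal_isHomogeneous (hd : ∀ i, IsHomogMap 𝒜 (δd i) (d i)) (S : Finset I) (j : I) :
    (coordIdeal 𝒜 ε d δd S j).IsHomogeneous 𝒜 := by
  rintro lam _ ⟨v, hv, hvS, rfl⟩
  exact ⟨_, decompose_mem_derSpan hd (lam - δd j) hv, fun i hi => by simp [hvS i hi],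
    congrArg (fun k => (DirectSum.decompose 𝒜 (v j) k : A)) (sub_add_cancel _ _)⟩

theorem coordIdeal_stable (hε : IsBichar ε) {D : Submodule F (Module.End F A)}
    (hD : DGraded 𝒜 ε D)
    (hdf : ∀ i δ, ∀ f ∈ D, IsColorDer 𝒜 ε δ f → d i * f = ε (δd i) δ • (f * d i))
    (S : Finset I) (j : I) {f : Module.End F A} (hf : f ∈ D) {a : A}
    (ha : a ∈ coordIdeal 𝒜 ε d δd S j) : f a ∈ coordIdeal 𝒜 ε d δd S j := by
  refine hD.induction (((coordIdeal 𝒜 ε d δd S j).restrictScalars F).comap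
    (LinearMap.applyₗ a : Module.End F A →ₗ[F] A)) ?_ hf
  intro δ f hf hδ
  obtain ⟨v, hv, hvS, rfl⟩ := ha
  exact ⟨_, map_mem_derSpan hε hδ (fun i => hdf i δ f hf hδ) hv,
    fun i hi => by simp [hvS i hi], rfl⟩

/-- Homogeneous `F₁`-independent derivations color-commuting with `D` are separated by `A`-linear
combinations of evaluations. -/
theorem exists_mem_derSpan (hε : IsBichar ε) (hcomm : IsColorComm 𝒜 ε)
    {D : Submodule F (Module.End F A)} (hD : DGraded 𝒜 ε D) (hDne : D ≠ ⊥)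
    (hsimple : GradedDSimple 𝒜 D) (hd : ∀ i, IsHomogMap 𝒜 (δd i) (d i))
    (hdf : ∀ i δ, ∀ f ∈ D, IsColorDer 𝒜 ε δ f → d i * f = ε (δd i) δ • (f * d i))
    (hdind : ∀ (s : Finset I) (c : I → A), (∀ i, c i ∈ F1 D) →
      (∑ i ∈ s, mulL F A (c i) * d i) = 0 → ∀ i ∈ s, c i = 0)
    (S : Finset I) : ∀ j ∉ S, ∃ v ∈ derSpan 𝒜 ε d δd, (∀ i ∈ S, v i = 0) ∧ v j = 1 := by
  induction S using Finset.strongInduction with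
  | H S ih =>
  intro m hm
  have hone : (1 : A) ≠ 0 := fun h => hDne <| by
    rw [eq_bot_iff]
    intro f _
    rw [Submodule.mem_bot]
    ext a
    rw [← mul_one a, h, mul_zero, map_zero, map_zero]
  rcases hsimple (coordIdeal 𝒜 ε d δd S m) (coordIdeal_isHomogeneous hd S m)
    (fun f hf x hx => coordIdeal_stable hε hD hdf S m hf hx) with hbot | htop
  swap
  · exact (htop ▸ Submodule.mem_top : (1 : A) ∈ coordIdeal 𝒜 ε d δd S m)
  exfalso
  have hvan : ∀ v ∈ derSpan 𝒜 ε d δd, (∀ i ∈ S, v i = 0) → v m = 0 := fun v hv hvS => by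
    have : v m ∈ coordIdeal 𝒜 ε d δd S m := ⟨v, hv, hvS, rfl⟩
    rwa [hbot] at this
  have hdual : ∀ i, ∃ w ∈ derSpan 𝒜 ε d δd, i ∈ S →
      (∀ k ∈ S, w k = if k = i then 1 else 0) ∧ w m ∈ 𝒜 (-δd i + δd m) := by
    intro i
    by_cases hi : i ∈ S
    · obtain ⟨v, hv, hvS, hvi⟩ := ih (S.erase i) (Finset.erase_ssubset hi) i (by simp)
      refine ⟨_, decompose_mem_derSpan hd (-δd i) hv, fun _ => ⟨fun k hk => ?_, SetLike.coe_mem _⟩⟩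
      by_cases hki : k = i
      · subst hki
        rw [hvi, neg_add_cancel, if_pos rfl]
        exact DirectSum.decompose_of_mem_same 𝒜 SetLike.GradedOne.one_mem
      · simp [hvS k (by simp [hk, hki]), hki]
    · exact ⟨0, zero_mem _, fun h => absurd h hi⟩
  choose w hw hwS using hdual
  have hF1 : ∀ i ∈ S, w i m ∈ F1 D := fun i hi => by
    refine mem_F1_of_homogeneous hD fun δ f hf hδ => ?_
    refine hvan _ (map_mem_derSpan hε hδ (fun k => hdf k δ f hf hδ) (hw i)) fun k hk => ?_
    rw [(hwS i hi).1 k hk]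
    split_ifs
    · exact hδ.map_one hε
    · exact map_zero f
  let c : I → A := fun i =>
    if i = m then -1 else if i ∈ S then ε (δd i) (-δd i + δd m) • w i m else 0
  have hc : ∀ i, c i ∈ F1 D := fun i => by
    simp only [c]
    split_ifs with h1 h2
    · exact neg_mem (mem_F1_of_homogeneous hD fun δ f _ hδ => hδ.map_one hε)
    · exact Submodule.smul_mem _ _ (hF1 i h2)
    · exact zero_mem _
  have hsum : ∑ i ∈ insert m S, mulL F A (c i) * d i = 0 := by
    apply linearMap_ext_homogeneous 𝒜
    intro β b hb
    have hb1 : (fun i => ε β (δd i) • (1 * d i b)) ∈ derSpan 𝒜 ε d δd :=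
      Submodule.subset_span ⟨0, β, 1, SetLike.GradedOne.one_mem, b, hb, rfl⟩
    have hrel := hvan _ (sub_mem hb1 (sum_mem fun i (_ : i ∈ S) =>
      smul_mem_derSpan (ε β (δd i) • (1 * d i b)) (hw i))) (fun k hk => by
        rw [Pi.sub_apply, Finset.sum_apply, Finset.sum_eq_single_of_mem k hk]
        · simp [(hwS k hk).1 k hk]
        · intro i hi hik
          simp [(hwS i hi).1 k hk, Ne.symm hik])
    rw [Pi.sub_apply, Finset.sum_apply, sub_eq_zero] at hrel
    have hterm : ∀ i ∈ S, ε β (δd i) • (1 * d i b) * w i m =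
        ε β (δd m) • ((mulL F A (c i) * d i) b) := fun i hi => by
      have him : i ≠ m := fun h => hm (h ▸ hi)
      have hbi := hε.2 β (δd i) (-δd i + δd m)
      rw [add_neg_cancel_left] at hbi
      simp only [c, if_neg him, if_pos hi, Module.End.mul_apply, mulL_apply, one_mul,
        smul_mul_assoc, hcomm _ _ _ (hd i _ _ hb) _ (hwS i hi).2, smul_smul, hε.add_left, hbi]
      congr 1
      ring
    rw [Finset.sum_congr rfl hterm, ← Finset.smul_sum, one_mul] at hrel
    have h3 := smul_right_injective A (hε.ne_zero β (δd m)) hrel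
    rw [Finset.sum_insert hm, LinearMap.add_apply, LinearMap.sum_apply, ← h3]
    simp [c]
  have := hdind _ c hc hsum m (Finset.mem_insert_self m S)
  simp [c, hone] at this

end derSpan

/-- The product of the `d i` along `l`, the head of `l` being the last factor. -/
def revWord (d : I → Module.End F A) : List I → Module.End F A
  | [] => 1
  | i :: l => revWord d l * d i

/-- The degree of `revWord`. -/
def wordDeg (δd : I → Γ) : List I → Γ
  | [] => 0
  | i :: l => wordDeg δd l + δd i

/-- The span of the `a d_{i₁} ⋯ d_{iₖ}` with `k < n`. -/
def wordSpan (d : I → Module.End F A) (n : ℕ) : Submodule F (Module.End F A) :=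
  Submodule.span F {x | ∃ a l, l.length < n ∧ x = mulL F A a * revWord d l}

/-- The symbol of the commutator of a word with an element `b` of `A`, as a function of the
family `i ↦ ε(b, d_i) d_i(b)`. -/
noncomputable def wordSymbol (ε : Γ → Γ → F) (d : I → Module.End F A) (δd : I → Γ) :
    List I → (I → A) →ₗ[F] Module.End F A
  | [] => 0
  | i :: l => LinearMap.mulRight F (d i) ∘ₗ wordSymbol ε d δd l +
      ε (wordDeg δd l) (δd i) • (LinearMap.mulRight F (revWord d l) ∘ₗ mulL F A ∘ₗ LinearMap.proj i)

section words

variable {𝒜 : Γ → Submodule F A} [GradedAlgebra 𝒜] {ε : Γ → Γ → F}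
  {d : I → Module.End F A} {δd : I → Γ}

theorem wordSymbol_cons (i : I) (l : List I) (v : I → A) :
    wordSymbol ε d δd (i :: l) v = wordSymbol ε d δd l v * d i +
      ε (wordDeg δd l) (δd i) • (mulL F A (v i) * revWord d l) := by
  simp [wordSymbol]

theorem revWord_append (l : List I) (i : I) : revWord d (l ++ [i]) = d i * revWord d l := by
  induction l with
  | nil => simp [revWord]
  | cons k l ih => simp [revWord, ih, mul_assoc]

theorem isHomogMap_revWord (hd : ∀ i, IsHomogMap 𝒜 (δd i) (d i)) (l : List I) :
    IsHomogMap 𝒜 (wordDeg δd l) (revWord d l) := by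
  induction l with
  | nil =>
    intro lam a ha
    simpa [revWord, wordDeg] using ha
  | cons i l ih => exact ih.mul (hd i)

theorem mulL_mul_revWord_mem (a : A) {l : List I} {n : ℕ} (h : l.length < n) :
    mulL F A a * revWord d l ∈ wordSpan d n :=
  Submodule.subset_span ⟨a, l, h, rfl⟩

theorem wordSpan_mono {m n : ℕ} (h : m ≤ n) : wordSpan d m ≤ wordSpan (F := F) d n := by
  refine Submodule.span_mono ?_
  rintro _ ⟨a, l, hl, rfl⟩
  exact ⟨a, l, hl.trans_le h, rfl⟩

theorem mulL_mul_mem_wordSpan (a : A) {n : ℕ} {x : Module.End F A} (hx : x ∈ wordSpan d n) :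
    mulL F A a * x ∈ wordSpan d n := by
  induction hx using Submodule.span_induction with
  | zero => simp
  | add x y _ _ hx hy => simpa [mul_add] using add_mem hx hy
  | smul r x _ hx => simpa using Submodule.smul_mem _ r hx
  | mem x hx =>
    obtain ⟨b, l, hl, rfl⟩ := hx
    rw [← mul_assoc, ← mulL_mul]
    exact mulL_mul_revWord_mem _ hl

theorem mul_mem_wordSpan_succ (i : I) {n : ℕ} {x : Module.End F A} (hx : x ∈ wordSpan d n) :
    x * d i ∈ wordSpan d (n + 1) := by
  induction hx using Submodule.span_induction with
  | zero => simp
  | add x y _ _ hx hy => simpa [add_mul] using add_mem hx hy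
  | smul r x _ hx => simpa using Submodule.smul_mem _ r hx
  | mem x hx =>
    obtain ⟨b, l, hl, rfl⟩ := hx
    exact Submodule.subset_span ⟨b, i :: l, by simpa using hl, by rw [revWord, mul_assoc]⟩

theorem revWord_mul_mulL (hε : IsBichar ε) (hd : ∀ i, IsColorDer 𝒜 ε (δd i) (d i)) (l : List I) :
    ∀ {lam : Γ} {a : A}, a ∈ 𝒜 lam →
      revWord d l * mulL F A a - ε (wordDeg δd l) lam • (mulL F A a * revWord d l) ∈
        wordSpan d l.length := by
  induction l with
  | nil =>
    intro lam a _
    simp [revWord, wordDeg, hε.zero_left]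
  | cons i l ih =>
    intro lam a ha
    have h1 := wordSpan_mono (Nat.le_succ _) (ih ((hd i).1 _ _ ha))
    have h2 := mulL_mul_revWord_mem (d := d) (F := F) (d i a) (Nat.lt_succ_self l.length)
    have h3 := mul_mem_wordSpan_succ i (ih ha)
    convert add_mem (add_mem h1
      (Submodule.smul_mem _ (ε (wordDeg δd l) (lam + δd i)) h2))
      (Submodule.smul_mem _ (ε (δd i) lam) h3) using 1
    · rfl
    simp only [revWord, wordDeg]
    rw [mul_assoc, (hd i).mul_mulL ha, mul_add, mul_smul_comm, sub_mul,
      smul_sub, smul_mul_assoc, smul_smul, hε.add_left, mul_assoc, mul_assoc,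
      mul_comm (ε (δd i) lam)]
    abel

/-- The commutator of `b` with a word, modulo words shorter by two letters. -/
theorem commutator_revWord (hε : IsBichar ε) (hd : ∀ i, IsColorDer 𝒜 ε (δd i) (d i))
    {β : Γ} {b : A} (hb : b ∈ 𝒜 β) (l : List I) :
    mulL F A b * revWord d l - ε β (wordDeg δd l) • (revWord d l * mulL F A b) +
      wordSymbol ε d δd l (fun i => ε β (δd i) • d i b) ∈ wordSpan d (l.length - 1) := by
  have h0 : ε β 0 = 1 := by simpa [hε.zero_left] using hε.1 β 0
  induction l with
  | nil => simp [revWord, wordDeg, wordSymbol, h0]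
  | cons i l ih =>
    have h1 : (mulL F A b * revWord d l - ε β (wordDeg δd l) • (revWord d l * mulL F A b) +
        wordSymbol ε d δd l (fun i => ε β (δd i) • d i b)) * d i ∈ wordSpan d l.length := by
      cases l with
      | nil => simp [revWord, wordDeg, wordSymbol, h0]
      | cons k l => exact mul_mem_wordSpan_succ i ih
    have h2 := revWord_mul_mulL hε hd l ((hd i).1 _ _ hb)
    convert sub_mem h1 (Submodule.smul_mem _ (ε β (wordDeg δd l) * ε β (δd i)) h2) using 1
    · rfl
    have h3 : revWord d l * mulL F A b * d i = ε β (δd i) •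
        (revWord d l * d i * mulL F A b - revWord d l * mulL F A (d i b)) := by
      rw [mul_assoc (revWord d l) (d i), (hd i).mul_mulL hb, mul_add, add_sub_cancel_left,
        mul_smul_comm, smul_smul, hε.1, one_smul, mul_assoc]
    rw [wordSymbol_cons, revWord, wordDeg, hε.2, add_mul, sub_mul, smul_mul_assoc, h3, map_smul,
      smul_mul_assoc]
    have h4 : ε (wordDeg δd l) (δd i) * ε β (δd i) =
        ε β (wordDeg δd l) * ε β (δd i) * ε (wordDeg δd l) (β + δd i) := by
      rw [hε.2]
      linear_combination (-(ε β (δd i) * ε (wordDeg δd l) (δd i))) * hε.1 β (wordDeg δd l)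
    simp only [smul_sub, smul_smul, h4, mul_assoc]
    abel

theorem mulL_mul_wordSymbol (a : A) (l : List I) (v : I → A) :
    mulL F A a * wordSymbol ε d δd l v = wordSymbol ε d δd l (fun i => a * v i) := by
  induction l with
  | nil => simp [wordSymbol]
  | cons i l ih =>
    rw [wordSymbol_cons, wordSymbol_cons, mul_add, ← mul_assoc, ih, mul_smul_comm, ← mul_assoc,
      mulL_mul]

theorem revWord_mem_AD {D : Submodule F (Module.End F A)} (hd : ∀ i, d i ∈ AD D) (l : List I) :
    revWord d l ∈ AD D := by
  induction l with
  | nil => exact one_mem _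
  | cons i l ih => exact mul_mem ih (hd i)

theorem mulL_mem_AD (D : Submodule F (Module.End F A)) (a : A) : mulL F A a ∈ AD D :=
  Algebra.subset_adjoin (Or.inl ⟨a, rfl⟩)

theorem wordSymbol_mem (hε : IsBichar ε) (hcomm : IsColorComm 𝒜 ε)
    {D : Submodule F (Module.End F A)} (hdAD : ∀ i, d i ∈ AD D)
    (hd : ∀ i, IsColorDer 𝒜 ε (δd i) (d i)) (l : List I) {v : I → A}
    (hv : v ∈ derSpan 𝒜 ε d δd) :
    wordSymbol ε d δd l v ∈ Wsub 𝒜 ε D ⊔ wordSpan d (l.length - 1) := by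
  suffices h : derSpan 𝒜 ε d δd ≤
      (Wsub 𝒜 ε D ⊔ wordSpan d (l.length - 1)).comap (wordSymbol ε d δd l) from h hv
  refine Submodule.span_le.2 ?_
  rintro _ ⟨γ, β, c, hc, b, hb, rfl⟩
  have h1 := mulL_mul_mem_wordSpan c (commutator_revWord hε hd hb l)
  rw [mul_add, mulL_mul_wordSymbol] at h1
  simp only [mul_smul_comm] at h1
  have h2 : mulL F A b * (mulL F A c * revWord d l) -
      ε β (γ + wordDeg δd l) • (mulL F A c * revWord d l * mulL F A b) ∈ Wsub 𝒜 ε D :=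
    Submodule.subset_span ⟨β, γ + wordDeg δd l, _, _, mulL_mem_AD D b,
      mul_mem (mulL_mem_AD D c) (revWord_mem_AD hdAD l), isHomogMap_mulL 𝒜 hb,
      (isHomogMap_mulL 𝒜 hc).mul (isHomogMap_revWord (fun i => (hd i).1) l), rfl⟩
  have h3 : mulL F A c * (mulL F A b * revWord d l -
      ε β (wordDeg δd l) • (revWord d l * mulL F A b)) ∈ Wsub 𝒜 ε D := by
    convert Submodule.smul_mem _ (ε γ β) h2 using 1
    rw [mul_sub, ← mul_assoc, hcomm.mulL_comm hc hb, mul_smul_comm, hε.2, smul_sub, smul_smul,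
      ← mul_assoc (ε γ β), hε.1, one_mul, smul_mul_assoc, mul_assoc, mul_assoc]
  rw [SetLike.mem_coe, Submodule.mem_comap]
  exact (add_mem_cancel_left (Submodule.mem_sup_left h3)).1 (Submodule.mem_sup_right h1)

theorem wordSymbol_eq_zero (l : List I) {v : I → A} (hv : ∀ i ∈ l, v i = 0) :
    wordSymbol ε d δd l v = 0 := by
  induction l with
  | nil => simp [wordSymbol]
  | cons i l ih =>
    rw [wordSymbol_cons, ih fun k hk => hv k (List.mem_cons_of_mem _ hk), hv i List.mem_cons_self]
    simp

theorem wordSymbol_mul_of_even (hε : IsBichar ε)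
    (hdd : ∀ i k, d i * d k = ε (δd i) (δd k) • (d k * d i)) {j : I}
    (hj : ε (δd j) (δd j) = 1) (l : List I) {v : I → A} (hv : ∀ i ∈ l, i ≠ j → v i = 0) :
    wordSymbol ε d δd l v * d j =
      ((l.count j : F) * ε (wordDeg δd l) (δd j)) • (mulL F A (v j) * revWord d l) := by
  induction l with
  | nil => simp [wordSymbol]
  | cons i l ih =>
    have ih := ih fun k hk => hv k (List.mem_cons_of_mem _ hk)
    rw [wordSymbol_cons, wordDeg, revWord, hε.add_left]
    by_cases hij : i = j
    · subst hij
      rw [ih, hj, List.count_cons_self, add_mul, smul_mul_assoc, smul_mul_assoc, ← add_smul,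
        mul_assoc]
      congr 1
      push_cast
      ring
    · rw [hv i List.mem_cons_self hij, List.count_cons_of_ne hij, map_zero, zero_mul, smul_zero,
        add_zero, mul_assoc, hdd, mul_smul_comm, ← mul_assoc, ih, smul_mul_assoc, smul_smul,
        mul_assoc (mulL F A (v j))]
      congr 1
      ring

theorem AD_le_of_wordSpan_le {D : Submodule F (Module.End F A)}
    (hd : ∀ i, IsColorDer 𝒜 ε (δd i) (d i))
    (hDspan : ∀ f ∈ D, ∃ (s : Finset I) (c : I → A), f = ∑ i ∈ s, mulL F A (c i) * d i)
    {P : Submodule F (Module.End F A)} (hP : ∀ n, wordSpan d n ≤ P) :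
    Subalgebra.toSubmodule (AD D) ≤ P := by
  let Q : Submodule F (Module.End F A) :=
    Submodule.span F {x | ∃ a l, x = mulL F A a * revWord d l}
  have hmulL : ∀ a : A, ∀ x ∈ Q, mulL F A a * x ∈ Q := fun a x hx => by
    induction hx using Submodule.span_induction with
    | zero => simp
    | add x y _ _ hx hy => simpa [mul_add] using add_mem hx hy
    | smul r x _ hx => simpa using Submodule.smul_mem _ r hx
    | mem x hx =>
      obtain ⟨b, l, rfl⟩ := hx
      exact Submodule.subset_span ⟨a * b, l, by rw [mulL_mul, mul_assoc]⟩
  have hder : ∀ i, ∀ x ∈ Q, d i * x ∈ Q := fun i x hx => by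
    induction hx using Submodule.span_induction with
    | zero => simp
    | add x y _ _ hx hy => simpa [mul_add] using add_mem hx hy
    | smul r x _ hx => simpa using Submodule.smul_mem _ r hx
    | mem x hx =>
      obtain ⟨b, l, rfl⟩ := hx
      induction b using DirectSum.Decomposition.inductionOn 𝒜 with
      | zero => simp
      | add a a₂ h h₂ => simpa [add_mul, mul_add] using add_mem h h₂
      | homogeneous b =>
        rw [← mul_assoc, (hd i).mul_mulL b.2, add_mul, smul_mul_assoc, mul_assoc,
          ← revWord_append]
        exact add_mem (Submodule.subset_span ⟨_, _, rfl⟩)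
          (Submodule.smul_mem _ _ (Submodule.subset_span ⟨_, _, rfl⟩))
  have hAD : ∀ x ∈ AD D, ∀ y ∈ Q, x * y ∈ Q := fun x hx => by
    induction hx using Algebra.adjoin_induction with
    | mem x hx =>
      rcases hx with ⟨a, rfl⟩ | hx
      · exact hmulL a
      · intro y hy
        obtain ⟨s, c, rfl⟩ := hDspan x hx
        rw [Finset.sum_mul]
        refine sum_mem fun i _ => ?_
        rw [mul_assoc]
        exact hmulL _ _ (hder i y hy)
    | algebraMap r =>
      intro y hy
      simpa [Algebra.algebraMap_eq_smul_one] using Submodule.smul_mem _ r hy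
    | add x x₂ _ _ hx hx₂ =>
      intro y hy
      rw [add_mul]
      exact add_mem (hx y hy) (hx₂ y hy)
    | mul x x₂ _ _ hx hx₂ =>
      intro y hy
      rw [mul_assoc]
      exact hx _ (hx₂ y hy)
  intro x hx
  have hxQ : x ∈ Q := by
    have h1 : (1 : Module.End F A) ∈ Q :=
      Submodule.subset_span ⟨1, [], by simp [mulL_one, revWord]⟩
    simpa using hAD x hx 1 h1
  refine (Submodule.span_le.2 ?_ : Q ≤ P) hxQ
  rintro _ ⟨a, l, rfl⟩
  exact hP (l.length + 1) (mulL_mul_revWord_mem a (Nat.lt_succ_self _))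

end words

theorem Wsub_le_AD (𝒜 : Γ → Submodule F A) (ε : Γ → Γ → F) (D : Submodule F (Module.End F A)) :
    Wsub 𝒜 ε D ≤ Subalgebra.toSubmodule (AD D) := by
  refine Submodule.span_le.2 ?_
  rintro _ ⟨γ, γ₂, x, y, hx, hy, -, -, rfl⟩
  exact (AD D).sub_mem (mul_mem hx hy) ((AD D).smul_mem (mul_mem hy hx) _)

theorem F1D_le_AD (D : Submodule F (Module.End F A)) : F1D D ≤ AD D :=
  Algebra.adjoin_mono (Set.union_subset_union_left _ (Set.image_subset_range _ _))

/-- If the set of exponents is infinite, there are infinitely many derivations, or an even one in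
characteristic zero. -/
theorem infinite_or_exists_even_of_infinite_inJ {ε : Γ → Γ → F} (hε : IsBichar ε) {δd : I → Γ}
    (hinf : {α : I →₀ ℕ | inJ ε δd α}.Infinite) :
    Infinite I ∨ CharZero F ∧ ∃ j, ε (δd j) (δd j) = 1 := by
  by_contra! ⟨hfin, hchar⟩
  refine hinf (Set.Finite.of_injOn (f := fun α : I →₀ ℕ => (α : I → ℕ))
    (t := Set.Iic fun _ => max (ringChar F - 1) 1) ?_ DFunLike.coe_injective.injOn ?_)
  · intro α hα i
    by_cases h0 : ringChar F = 0
    · have : CharP F 0 := h0 ▸ ringChar.charP F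
      have hne := hchar (CharP.charP_to_charZero F) i
      have hsq := mul_self_eq_one_iff.1 (hε.1 (δd i) (δd i))
      exact le_max_of_le_right (hα.2 i (hsq.resolve_left hne))
    · exact le_max_of_le_left (hα.1 i h0)
  · have := Fintype.ofFinite I
    exact Set.finite_Iic _

theorem stmt_12
    (𝒜 : Γ → Submodule F A) [GradedAlgebra 𝒜] (ε : Γ → Γ → F)
    (D : Submodule F (Module.End F A))
    (hchar : (2 : F) ≠ 0)
    (hbich : IsBichar ε)
    (hcomm : IsColorComm 𝒜 ε)
    (hDder : D ≤ DerE 𝒜 ε)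
    (hDgr : DGraded 𝒜 ε D)
    (hDcc : DColorComm 𝒜 ε D)
    (hDne : D ≠ ⊥)
    (hsimple : GradedDSimple 𝒜 D)
    (d : I → Module.End F A) (δd : I → Γ)
    (hdD : ∀ i, d i ∈ DScr 𝒜 ε D)
    (hdhom : ∀ i, IsColorDer 𝒜 ε (δd i) (d i))
    (hdspan : ∀ f ∈ DScr 𝒜 ε D, ∃ (s : Finset I) (c : I → A),
      (∀ i, c i ∈ F1 D) ∧ f = ∑ i ∈ s, mulL F A (c i) * d i)
    (hdind : ∀ (s : Finset I) (c : I → A), (∀ i, c i ∈ F1 D) →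
      (∑ i ∈ s, mulL F A (c i) * d i) = 0 → ∀ i ∈ s, c i = 0)
    (hinf : {α : I →₀ ℕ | inJ ε δd α}.Infinite) :
    Wsub 𝒜 ε D = Subalgebra.toSubmodule (AD D) := by
  have hdAD : ∀ i, d i ∈ AD D := fun i => F1D_le_AD D (hdD i).1
  have hsep := exists_mem_derSpan hbich hcomm hDgr hDne hsimple (fun i => (hdhom i).1)
    (fun i δ f hf hδ => F1D_comm_D hbich hDgr hDcc (hdD i).1 (hdhom i).1 hf hδ) hdind
  refine le_antisymm (Wsub_le_AD 𝒜 ε D) (AD_le_of_wordSpan_le hdhom (fun f hf => ?_) fun n => ?_)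
  · obtain ⟨s, c, -, h⟩ := hdspan f ⟨Algebra.subset_adjoin (Or.inr hf), hDder hf⟩
    exact ⟨s, c, h⟩
  induction n using Nat.strong_induction_on with
  | _ n ih =>
  refine Submodule.span_le.2 ?_
  rintro _ ⟨a, l, hl, rfl⟩
  have key : ∃ j : I, ∃ v ∈ derSpan 𝒜 ε d δd, ∃ r : F, r ≠ 0 ∧
      wordSymbol ε d δd (j :: l) v = r • revWord d l := by
    rcases infinite_or_exists_even_of_infinite_inJ hbich hinf with hI | ⟨hF, j, hj⟩
    · obtain ⟨j, hj⟩ := Infinite.exists_notMem_finset l.toFinset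
      obtain ⟨v, hv, hvl, hvj⟩ := hsep l.toFinset j hj
      refine ⟨j, v, hv, _, hbich.ne_zero (wordDeg δd l) (δd j), ?_⟩
      rw [wordSymbol_cons, wordSymbol_eq_zero l fun i hi => hvl i (List.mem_toFinset.2 hi), hvj,
        mulL_one, zero_mul, zero_add, one_mul]
    · obtain ⟨v, hv, hvl, hvj⟩ := hsep (l.toFinset.erase j) j (by simp)
      refine ⟨j, v, hv, ((l.count j + 1 : ℕ) : F) * ε (wordDeg δd l) (δd j),
        mul_ne_zero (Nat.cast_ne_zero.2 (Nat.succ_ne_zero _)) (hbich.ne_zero _ _), ?_⟩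
      rw [wordSymbol_cons, wordSymbol_mul_of_even hbich (fun i k =>
        F1D_comm hbich hcomm hDgr hDcc (hdD i).1 (hdhom i).1 (hdD k).1 (hdhom k).1) hj l
        fun i hi hij => hvl i (by simp [hi, hij]), hvj, mulL_one, one_mul, ← add_smul]
      congr 1
      push_cast
      ring
  obtain ⟨j, v, hv, r, hr, hs⟩ := key
  have hmem := wordSymbol_mem hbich hcomm hdAD hdhom (j :: l) (smul_mem_derSpan a hv)
  rw [← mulL_mul_wordSymbol, hs, mul_smul_comm] at hmem
  exact (Submodule.smul_mem_iff _ hr).1 (sup_le le_rfl (ih l.length hl) hmem)
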